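/- In the IRL1 setting with level-set boundedness, assume additionally that f is twice continuously differentiable. Let x* be a limit point of {x^k} with eventual support I* = {i : x_i* ≠ 0}, and suppose the matrix H indexed by I* × I*, given by H = [∇²f(x*)]_{I*, I*} + λ · diag(p(p−1)|x_i*|^{p−2} : i ∈ I*), is nonsingular. Then x* is the unique limit point of {x^k}, i.e., x^k → x*. -/

import Mathlib

open Filter Topology

/-- The weight function `w(t, s) = p(|t| + s)^(p-1)`. -/
noncomputable def wfun (p t s : ℝ) : ℝ := p * (|t| + s) ^ (p - 1)

/-- The IRL1 setting (Algorithm 2.1 of the paper): fixed data `p ∈ (0,1)`, `λ > 0`,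
`μ ∈ (0,1)`, a differentiable `f` with `Lf`-Lipschitz gradient (`Lf ≥ 0`), iterates
`x^k`, positive parameters `ε^k` with `ε^{k+1} ≤ μ ε^k` componentwise, and for each `k`
a differentiable model `Q_k` with `∇Q_k(x^k) = ∇f(x^k)`, `M`-strongly convex with
`M > Lf/2` (strong convexity meaning `z ↦ Q_k z - (M/2)‖z‖²` is convex), `∇Q_k`
`L`-Lipschitz, such that `x^{k+1}` is a global minimizer of
`G(·; x^k, ε^k) = Q_k(·) + λ Σᵢ w(xᵢ^k, εᵢ^k)|·ᵢ|`. -/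
structure IRL1 (n : ℕ) where
  p : ℝ
  lam : ℝ
  mu : ℝ
  Lf : ℝ
  M : ℝ
  L : ℝ
  f : EuclideanSpace ℝ (Fin n) → ℝ
  x : ℕ → EuclideanSpace ℝ (Fin n)
  eps : ℕ → Fin n → ℝ
  Q : ℕ → EuclideanSpace ℝ (Fin n) → ℝ
  hp0 : 0 < p
  hp1 : p < 1
  hlam : 0 < lam
  hmu0 : 0 < mu
  hmu1 : mu < 1
  hLf : 0 ≤ Lf
  hM : Lf / 2 < M
  hf_diff : Differentiable ℝ f
  hf_lip : ∀ a b, ‖gradient f a - gradient f b‖ ≤ Lf * ‖a - b‖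
  heps_pos : ∀ k i, 0 < eps k i
  heps_dec : ∀ k i, eps (k + 1) i ≤ mu * eps k i
  hQ_diff : ∀ k, Differentiable ℝ (Q k)
  hQ_grad : ∀ k, gradient (Q k) (x k) = gradient f (x k)
  hQ_sconv : ∀ k, ConvexOn ℝ Set.univ (fun z => Q k z - M / 2 * ‖z‖ ^ 2)
  hQ_lip : ∀ k a b, ‖gradient (Q k) a - gradient (Q k) b‖ ≤ L * ‖a - b‖
  hmin : ∀ k, ∀ z : EuclideanSpace ℝ (Fin n),
    Q k (x (k + 1)) + lam * ∑ i, wfun p (x k i) (eps k i) * |x (k + 1) i|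
      ≤ Q k z + lam * ∑ i, wfun p (x k i) (eps k i) * |z i|

/-- The smoothed objective `F(x, ε) = f(x) + λ Σᵢ (|xᵢ| + εᵢ)^p`. -/
noncomputable def IRL1.Feps {n : ℕ} (S : IRL1 n)
    (z : EuclideanSpace ℝ (Fin n)) (e : Fin n → ℝ) : ℝ :=
  S.f z + S.lam * ∑ i, (|z i| + e i) ^ S.p

/-- The objective `F(x) = f(x) + λ Σᵢ |xᵢ|^p`. -/
noncomputable def IRL1.Fobj {n : ℕ} (S : IRL1 n) (z : EuclideanSpace ℝ (Fin n)) : ℝ :=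
  S.f z + S.lam * ∑ i, |z i| ^ S.p

/-- The subproblem objective `G(z; x^k, ε^k)`. -/
noncomputable def IRL1.G {n : ℕ} (S : IRL1 n) (k : ℕ)
    (z : EuclideanSpace ℝ (Fin n)) : ℝ :=
  S.Q k z + S.lam * ∑ i, wfun S.p (S.x k i) (S.eps k i) * |z i|

/-- The level set `{x : F(x) ≤ F(x⁰, ε⁰)}` is bounded. -/
def IRL1.LevelBounded {n : ℕ} (S : IRL1 n) : Prop :=
  Bornology.IsBounded {z : EuclideanSpace ℝ (Fin n) | S.Fobj z ≤ S.Feps (S.x 0) (S.eps 0)}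


lemma aux_convex_grad {E : Type*} [NormedAddCommGroup E] [InnerProductSpace ℝ E]
    {Q : E → ℝ} {M : ℝ} (hd : Differentiable ℝ Q)
    (hc : ConvexOn ℝ Set.univ (fun z => Q z - M / 2 * ‖z‖ ^ 2)) (x y : E) :
    Q x + fderiv ℝ Q x (y - x) + M / 2 * ‖y - x‖ ^ 2 ≤ Q y := by
  have h1 : ConvexOn ℝ Set.univ (fun t : ℝ => Q (AffineMap.lineMap x y t) -
      M / 2 * ‖(AffineMap.lineMap x y t : E)‖ ^ 2) :=
    hc.comp_affineMap (AffineMap.lineMap (k := ℝ) x y)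
  have hl : HasDerivAt (fun t : ℝ => (AffineMap.lineMap x y t : E)) (y - x) 0 :=
    AffineMap.hasDerivAt_lineMap
  have h2 : HasDerivAt (fun t : ℝ => Q (AffineMap.lineMap x y t) -
      M / 2 * ‖(AffineMap.lineMap x y t : E)‖ ^ 2)
      (fderiv ℝ Q x (y - x) - M / 2 * (2 * inner ℝ x (y - x))) 0 := by
    have hq : HasFDerivAt Q (fderiv ℝ Q x) (AffineMap.lineMap x y (0 : ℝ)) := by
      simpa using (hd x).hasFDerivAt
    have := (hq.comp_hasDerivAt (0 : ℝ) hl).sub ((hl.norm_sq).const_mul (M / 2))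
    simp only [AffineMap.lineMap_apply_zero] at this
    exact this
  have h3 := h1.le_slope_of_hasDerivAt (Set.mem_univ 0) (Set.mem_univ 1) zero_lt_one h2
  simp [slope_def_field] at h3
  have h4 : ‖y - x‖ ^ 2 = ‖y‖ ^ 2 - ‖x‖ ^ 2 - 2 * inner ℝ x (y - x) := by
    rw [norm_sub_sq_real, inner_sub_right, real_inner_self_eq_norm_sq, real_inner_comm]; ring
  rw [h4, map_sub]; linarith

lemma aux_descent {E : Type*} [NormedAddCommGroup E] [InnerProductSpace ℝ E] [CompleteSpace E]
    {f : E → ℝ} {L : ℝ} (hd : Differentiable ℝ f)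
    (hl : ∀ a b, ‖gradient f a - gradient f b‖ ≤ L * ‖a - b‖) (x y : E) :
    f y ≤ f x + fderiv ℝ f x (y - x) + L / 2 * ‖y - x‖ ^ 2 := by
  set d := y - x with hdd
  have hder : ∀ t : ℝ, HasDerivAt (fun t : ℝ => f (x + t • d) - t * fderiv ℝ f x d
      - L / 2 * ‖d‖ ^ 2 * t ^ 2)
      (fderiv ℝ f (x + t • d) d - fderiv ℝ f x d - L / 2 * ‖d‖ ^ 2 * (2 * t)) t := by
    intro t
    have hl : HasDerivAt (fun t : ℝ => x + t • d) d t := by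
      simpa using ((hasDerivAt_id t).smul_const d).const_add x
    have h1 := (hd (x + t • d)).hasFDerivAt.comp_hasDerivAt t hl
    have h2 := (hasDerivAt_id t).mul_const (fderiv ℝ f x d)
    have h3 := ((hasDerivAt_id t).pow 2).const_mul (L / 2 * ‖d‖ ^ 2)
    convert! (h1.sub h2).sub h3 using 1
    simp
  have hanti : AntitoneOn (fun t : ℝ => f (x + t • d) - t * fderiv ℝ f x d
      - L / 2 * ‖d‖ ^ 2 * t ^ 2) (Set.Icc 0 1) := by
    apply antitoneOn_of_deriv_nonpos (convex_Icc 0 1)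
    · exact fun t _ => (hder t).continuousAt.continuousWithinAt
    · exact fun t _ => (hder t).differentiableAt.differentiableWithinAt
    · intro t ht
      rw [interior_Icc] at ht
      rw [(hder t).deriv, ← inner_gradient_left, ← inner_gradient_left, ← inner_sub_left]
      have h1 := real_inner_le_norm (gradient f (x + t • d) - gradient f x) d
      have h2 := hl (x + t • d) x
      have h3 : ‖x + t • d - x‖ = t * ‖d‖ := by
        rw [add_sub_cancel_left, norm_smul, Real.norm_of_nonneg ht.1.le]
      rw [h3] at h2
      nlinarith [mul_le_mul_of_nonneg_right h2 (norm_nonneg d)]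
  have := hanti (Set.left_mem_Icc.2 zero_le_one) (Set.right_mem_Icc.2 zero_le_one) zero_le_one
  simp [hdd] at this
  rw [← hdd] at this
  rw [hdd]; simp only [map_sub] at *; linarith

lemma aux_rpow_concave {p a b : ℝ} (hp0 : 0 < p) (hp1 : p < 1) (ha : 0 < a) (hb : 0 < b) :
    b ^ p ≤ a ^ p + p * a ^ (p - 1) * (b - a) := by
  have hc := Real.concaveOn_rpow hp0.le hp1.le
  have hd : HasDerivAt (fun x : ℝ => x ^ p) (p * a ^ (p - 1)) a :=
    Real.hasDerivAt_rpow_const (Or.inl ha.ne')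
  rcases lt_trichotomy a b with h | h | h
  · have := hc.slope_le_of_hasDerivAt (Set.mem_Ici.2 ha.le) (Set.mem_Ici.2 hb.le) h hd
    rw [slope_def_field, div_le_iff₀ (by linarith)] at this
    linarith
  · subst h; simp
  · have := hc.le_slope_of_hasDerivAt (Set.mem_Ici.2 hb.le) (Set.mem_Ici.2 ha.le) h hd
    rw [slope_def_field, le_div_iff₀ (by linarith)] at this
    linarith

lemma aux_rpow_diff {p t e δ : ℝ} (hp0 : 0 < p) (hp1 : p < 1) (hδ : 0 < δ) (ht : δ ≤ t)
    (he : 0 < e) : |(t + e) ^ (p - 1) - t ^ (p - 1)| ≤ δ ^ (p - 2) * e := by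
  have ht0 : 0 < t := by linarith
  have h1 : (t + e) ^ (p - 1) ≤ t ^ (p - 1) :=
    Real.rpow_le_rpow_of_nonpos ht0 (by linarith) (by linarith)
  rw [abs_of_nonpos (by linarith)]
  have h2 : t ^ p ≤ (t + e) ^ p := Real.rpow_le_rpow ht0.le (by linarith) hp0.le
  have h3 : t ^ (p - 2) ≤ δ ^ (p - 2) :=
    Real.rpow_le_rpow_of_nonpos hδ ht (by linarith)
  have h4 : (t + e) ^ p = (t + e) ^ (p - 1) * (t + e) := by
    rw [← Real.rpow_add_one (by linarith)]; ring_nf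
  have h5 : t ^ p = t ^ (p - 1) * t := by
    rw [← Real.rpow_add_one (by linarith)]; ring_nf
  have h6 : t ^ (p - 1) = t ^ (p - 2) * t := by
    rw [← Real.rpow_add_one (by linarith)]; ring_nf
  have h7 := mul_le_mul_of_nonneg_right h3 he.le
  rw [h4, h5] at h2
  have h8 : t * (t ^ (p - 1) - (t + e) ^ (p - 1)) ≤ t * (t ^ (p - 2) * e) := by
    have : t * (t ^ (p - 2) * e) = t ^ (p - 1) * e := by rw [h6]; ring
    rw [this]
    nlinarith
  have := le_of_mul_le_mul_left h8 ht0
  linarith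

lemma aux_min_strong {n : ℕ} (S : IRL1 n) (k : ℕ) :
    S.G k (S.x (k+1)) + S.M / 2 * ‖S.x k - S.x (k+1)‖ ^ 2 ≤ S.G k (S.x k) := by
  have hs : StrongConvexOn Set.univ S.M (S.Q k) := strongConvexOn_iff_convex.2 (S.hQ_sconv k)
  set x := S.x k
  set y := S.x (k+1) with hy
  have key : ∀ t : ℝ, 0 < t → t < 1 →
      S.G k y + S.M / 2 * (1 - t) * ‖x - y‖ ^ 2 ≤ S.G k x := by
    intro t ht0 ht1
    have h1 := S.hmin k (t • x + (1 - t) • y)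
    have h2 := hs.2 (Set.mem_univ x) (Set.mem_univ y) ht0.le (by linarith : 0 ≤ 1 - t) (by ring)
    have h3 : ∑ i, wfun S.p (S.x k i) (S.eps k i) * |(t • x + (1 - t) • y) i| ≤
        t * ∑ i, wfun S.p (S.x k i) (S.eps k i) * |x i| +
        (1 - t) * ∑ i, wfun S.p (S.x k i) (S.eps k i) * |y i| := by
      rw [Finset.mul_sum, Finset.mul_sum, ← Finset.sum_add_distrib]
      refine Finset.sum_le_sum fun i _ => ?_
      have hw : 0 ≤ wfun S.p (S.x k i) (S.eps k i) := by
        have := S.heps_pos k i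
        have := S.hp0
        unfold wfun; positivity
      have : |(t • x + (1 - t) • y) i| ≤ t * |x i| + (1 - t) * |y i| := by
        simp only [PiLp.add_apply, PiLp.smul_apply, smul_eq_mul]
        refine (abs_add_le _ _).trans ?_
        rw [abs_mul, abs_mul, abs_of_pos ht0, abs_of_pos (by linarith : 0 < 1 - t)]
      nlinarith [mul_le_mul_of_nonneg_left this hw]
    have h4 := mul_le_mul_of_nonneg_left h3 S.hlam.le
    simp only [smul_eq_mul] at h2
    have h5 : t * (S.G k y + S.M / 2 * (1 - t) * ‖x - y‖ ^ 2) ≤ t * S.G k x := by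
      unfold IRL1.G
      rw [← hy] at h1
      nlinarith
    exact le_of_mul_le_mul_left h5 ht0
  have hlim : Tendsto (fun t : ℝ => S.G k y + S.M / 2 * (1 - t) * ‖x - y‖ ^ 2) (𝓝[>] 0)
      (𝓝 (S.G k y + S.M / 2 * (1 - 0) * ‖x - y‖ ^ 2)) := by
    apply Tendsto.mono_left _ nhdsWithin_le_nhds
    exact Continuous.tendsto (by fun_prop) 0
  have := le_of_tendsto hlim (by
    filter_upwards [Ioo_mem_nhdsGT (zero_lt_one' ℝ)] with t ht
    exact key t ht.1 ht.2)
  simpa using this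

lemma aux_decrease {n : ℕ} (S : IRL1 n) (k : ℕ) :
    S.Feps (S.x (k+1)) (S.eps (k+1)) + (S.M - S.Lf / 2) * ‖S.x (k+1) - S.x k‖ ^ 2
      ≤ S.Feps (S.x k) (S.eps k) := by
  have h1 := aux_min_strong S k
  have h2 := aux_convex_grad (S.hQ_diff k) (S.hQ_sconv k) (S.x k) (S.x (k+1))
  have h3 := aux_descent S.hf_diff S.hf_lip (S.x k) (S.x (k+1))
  rw [← inner_gradient_left, S.hQ_grad, inner_gradient_left] at h2
  rw [norm_sub_rev] at h1
  have h4 : ∑ i, (|S.x (k+1) i| + S.eps (k+1) i) ^ S.p ≤ ∑ i, (|S.x k i| + S.eps k i) ^ S.p +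
      (∑ i, wfun S.p (S.x k i) (S.eps k i) * |S.x (k+1) i| -
      ∑ i, wfun S.p (S.x k i) (S.eps k i) * |S.x k i|) := by
    rw [← Finset.sum_sub_distrib, ← Finset.sum_add_distrib]
    refine Finset.sum_le_sum fun i _ => ?_
    have e0 := S.heps_pos k i
    have e1 := S.heps_pos (k+1) i
    have e2 : S.eps (k+1) i ≤ S.eps k i := by
      have := S.heps_dec k i
      nlinarith [S.hmu1]
    have a1 : (|S.x (k+1) i| + S.eps (k+1) i) ^ S.p ≤ (|S.x (k+1) i| + S.eps k i) ^ S.p :=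
      Real.rpow_le_rpow (by positivity) (by linarith) S.hp0.le
    have a2 := aux_rpow_concave (a := |S.x k i| + S.eps k i) (b := |S.x (k+1) i| + S.eps k i)
      S.hp0 S.hp1 (by positivity) (by positivity)
    unfold wfun
    linarith
  have h5 := mul_le_mul_of_nonneg_left h4 S.hlam.le
  unfold IRL1.G at h1
  unfold IRL1.Feps
  nlinarith

lemma aux_eps {n : ℕ} (S : IRL1 n) (i : Fin n) : Tendsto (fun k => S.eps k i) atTop (𝓝 0) := by
  have hb : ∀ k, S.eps k i ≤ S.mu ^ k * S.eps 0 i := by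
    intro k
    induction k with
    | zero => simp
    | succ k ih =>
      have := S.heps_dec k i
      have := mul_le_mul_of_nonneg_left ih S.hmu0.le
      rw [pow_succ]; linarith
  refine squeeze_zero (fun k => (S.heps_pos k i).le) hb ?_
  simpa using (tendsto_pow_atTop_nhds_zero_of_lt_one S.hmu0.le S.hmu1).mul_const (S.eps 0 i)

lemma aux_step {n : ℕ} (S : IRL1 n) (xstar : EuclideanSpace ℝ (Fin n))
    (hcluster : ∃ φ : ℕ → ℕ, StrictMono φ ∧
      Tendsto (fun k => S.x (φ k)) atTop (nhds xstar)) :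
    Tendsto (fun k => ‖S.x (k+1) - S.x k‖) atTop (𝓝 0) := by
  obtain ⟨φ, hφ, hx⟩ := hcluster
  have hc : 0 < S.M - S.Lf / 2 := by linarith [S.hM]
  have hanti : Antitone (fun k => S.Feps (S.x k) (S.eps k)) := by
    refine antitone_nat_of_succ_le fun k => ?_
    have := aux_decrease S k
    nlinarith [mul_nonneg hc.le (sq_nonneg ‖S.x (k+1) - S.x k‖)]
  have hsub : Tendsto ((fun k => S.Feps (S.x k) (S.eps k)) ∘ φ) atTop (𝓝 (S.Fobj xstar)) := by
    unfold IRL1.Feps IRL1.Fobj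
    refine (S.hf_diff.continuous.continuousAt.tendsto.comp hx).add (Tendsto.const_mul _ ?_)
    refine tendsto_finsetSum _ fun i _ => ?_
    have h1 : Tendsto (fun k => |S.x (φ k) i|) atTop (𝓝 |xstar i|) :=
      (((EuclideanSpace.proj (𝕜 := ℝ) i).continuous.tendsto xstar).comp hx).abs
    have h2 := h1.add ((aux_eps S i).comp hφ.tendsto_atTop)
    rw [add_zero] at h2
    exact h2.rpow_const (Or.inr S.hp0.le)
  have hlim := (tendsto_iff_tendsto_subseq_of_antitone hanti hφ.tendsto_atTop).2 hsub
  have hdiff := hlim.sub (hlim.comp (tendsto_add_atTop_nat 1))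
  rw [sub_self] at hdiff
  have hsq : Tendsto (fun k => ‖S.x (k+1) - S.x k‖ ^ 2) atTop (𝓝 0) := by
    have h0 := hdiff.div_const (S.M - S.Lf / 2)
    rw [zero_div] at h0
    refine squeeze_zero (fun k => sq_nonneg _) (fun k => ?_) h0
    rw [le_div_iff₀ hc]
    have := aux_decrease S k
    simp only [Function.comp]
    linarith
  have := hsq.sqrt
  simpa [Real.sqrt_sq] using this

lemma aux_opt {n : ℕ} (S : IRL1 n) (k : ℕ) (i : Fin n) (hne : S.x (k+1) i ≠ 0) :
    fderiv ℝ (S.Q k) (S.x (k+1)) (EuclideanSpace.single i 1) +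
      S.lam * (wfun S.p (S.x k i) (S.eps k i) * (SignType.sign (S.x (k+1) i) : ℝ)) = 0 := by
  set y := S.x (k+1) with hy
  set e : EuclideanSpace ℝ (Fin n) := EuclideanSpace.single i 1 with he
  have hmin : ∀ t : ℝ, S.Q k (y + (0:ℝ) • e) + S.lam * (wfun S.p (S.x k i) (S.eps k i) * |y i + 0|)
      ≤ S.Q k (y + t • e) + S.lam * (wfun S.p (S.x k i) (S.eps k i) * |y i + t|) := by
    intro t
    have h := S.hmin k (y + t • e)
    rw [← Finset.add_sum_erase _ _ (Finset.mem_univ i),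
      ← Finset.add_sum_erase _ (fun j => wfun S.p (S.x k j) (S.eps k j) * |(y + t • e) j|)
        (Finset.mem_univ i)] at h
    have h2 : ∑ j ∈ Finset.univ.erase i, wfun S.p (S.x k j) (S.eps k j) * |(y + t • e) j| =
        ∑ j ∈ Finset.univ.erase i, wfun S.p (S.x k j) (S.eps k j) * |y j| := by
      refine Finset.sum_congr rfl fun j hj => ?_
      have : j ≠ i := Finset.ne_of_mem_erase hj
      simp [he, this]
    rw [h2] at h
    have h3 : (y + t • e) i = y i + t := by simp [he]
    rw [h3] at h
    simp only [zero_smul, add_zero]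
    rw [← hy] at h
    linarith
  have hl : HasDerivAt (fun t : ℝ => y + t • e) e 0 := by
    simpa using ((hasDerivAt_id (0:ℝ)).smul_const e).const_add y
  have hq : HasFDerivAt (S.Q k) (fderiv ℝ (S.Q k) y) (y + (0:ℝ) • e) := by
    simpa using (S.hQ_diff k y).hasFDerivAt
  have ha : HasDerivAt (fun t : ℝ => |y i + t|) (SignType.sign (y i) : ℝ) 0 := by
    have h0 : HasDerivAt (fun t : ℝ => |t|) (SignType.sign (y i) : ℝ) (y i + 0) := by
      simpa using hasDerivAt_abs hne
    have h1 := h0.comp (0:ℝ) ((hasDerivAt_id (0:ℝ)).const_add (y i))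
    rw [mul_one] at h1
    exact h1
  have hd := (hq.comp_hasDerivAt (0:ℝ) hl).add
    ((ha.const_mul (wfun S.p (S.x k i) (S.eps k i))).const_mul S.lam)
  exact IsLocalMin.hasDerivAt_eq_zero (Filter.Eventually.of_forall hmin) hd

lemma aux_resid {n : ℕ} (S : IRL1 n) (k : ℕ) (i : Fin n) (hne : S.x (k+1) i ≠ 0) :
    |fderiv ℝ S.f (S.x k) (EuclideanSpace.single i 1) +
      S.lam * (wfun S.p (S.x k i) (S.eps k i) * (SignType.sign (S.x (k+1) i) : ℝ))|
      ≤ S.L * ‖S.x (k+1) - S.x k‖ := by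
  have h := aux_opt S k i hne
  have h2 : fderiv ℝ S.f (S.x k) (EuclideanSpace.single i 1) +
      S.lam * (wfun S.p (S.x k i) (S.eps k i) * (SignType.sign (S.x (k+1) i) : ℝ)) =
      inner ℝ (gradient (S.Q k) (S.x k) - gradient (S.Q k) (S.x (k+1)))
        (EuclideanSpace.single i 1 : EuclideanSpace ℝ (Fin n)) := by
    rw [inner_sub_left, S.hQ_grad, inner_gradient_left, inner_gradient_left]
    linarith
  rw [h2]
  refine (abs_real_inner_le_norm _ _).trans ?_
  have := S.hQ_lip k (S.x k) (S.x (k+1))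
  rw [norm_sub_rev (S.x k)] at this
  simpa using this

/-- The reduced stationarity residual on the support, with frozen signs. -/
noncomputable def auxPhi {n : ℕ} (S : IRL1 n) (xstar : EuclideanSpace ℝ (Fin n))
    (Istar : Finset (Fin n)) (z : EuclideanSpace ℝ (Fin n)) : Istar → ℝ := fun i =>
  fderiv ℝ S.f z (EuclideanSpace.single (i : Fin n) 1) +
    S.lam * (S.p * |z (i : Fin n)| ^ (S.p - 1) * (SignType.sign (xstar (i : Fin n)) : ℝ))

/-- The derivative of the residual at the limit point. -/
noncomputable def auxD {n : ℕ} (S : IRL1 n) (xstar : EuclideanSpace ℝ (Fin n))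
    (Istar : Finset (Fin n)) : EuclideanSpace ℝ (Fin n) →L[ℝ] (Istar → ℝ) :=
  ContinuousLinearMap.pi fun i =>
    (ContinuousLinearMap.apply ℝ ℝ (EuclideanSpace.single (i : Fin n) (1:ℝ))).comp
      (fderiv ℝ (fderiv ℝ S.f) xstar) +
    (S.lam * (S.p * (S.p - 1) * |xstar (i : Fin n)| ^ (S.p - 2))) •
      (EuclideanSpace.proj (𝕜 := ℝ) (i : Fin n))

lemma auxPhi_hasFDerivAt {n : ℕ} (S : IRL1 n) (hC2 : ContDiff ℝ 2 S.f)
    (xstar : EuclideanSpace ℝ (Fin n)) (Istar : Finset (Fin n))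
    (hIstar : ∀ i : Fin n, i ∈ Istar ↔ xstar i ≠ 0) :
    HasFDerivAt (auxPhi S xstar Istar) (auxD S xstar Istar) xstar := by
  rw [hasFDerivAt_pi']
  intro i
  have hne : xstar (i : Fin n) ≠ 0 := (hIstar i).1 i.2
  have hf' : Differentiable ℝ (fderiv ℝ S.f) :=
    (hC2.fderiv_right (m := 1) (by norm_num)).differentiable (by norm_num)
  have h1 : HasFDerivAt (fun z => fderiv ℝ S.f z (EuclideanSpace.single (i : Fin n) (1:ℝ)))
      ((ContinuousLinearMap.apply ℝ ℝ (EuclideanSpace.single (i : Fin n) (1:ℝ))).comp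
      (fderiv ℝ (fderiv ℝ S.f) xstar)) xstar :=
    (ContinuousLinearMap.apply ℝ ℝ
      (EuclideanSpace.single (i : Fin n) (1:ℝ))).hasFDerivAt.comp xstar (hf' xstar).hasFDerivAt
  have h2 : HasDerivAt (fun t : ℝ => S.lam * (S.p * |t| ^ (S.p - 1) *
      (SignType.sign (xstar (i : Fin n)) : ℝ)))
      (S.lam * (S.p * (S.p - 1) * |xstar (i : Fin n)| ^ (S.p - 2))) (xstar (i : Fin n)) := by
    have h3 := (((hasDerivAt_abs hne).rpow_const (p := S.p - 1)
      (Or.inl (abs_ne_zero.2 hne))).const_mul S.p).mul_const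
        (SignType.sign (xstar (i : Fin n)) : ℝ) |>.const_mul S.lam
    convert! h3 using 1
    have hs : (SignType.sign (xstar (i : Fin n)) : ℝ) * (SignType.sign (xstar (i : Fin n)) : ℝ)
        = 1 := by
      rcases lt_or_gt_of_ne hne with h | h <;> simp [sign_neg, sign_pos, h]
    have he : S.p - 1 - 1 = S.p - 2 := by ring
    rw [he]
    linear_combination (-(S.lam * (S.p * (S.p - 1) * |xstar (i : Fin n)| ^ (S.p - 2)))) * hs
  have h4 : HasFDerivAt (fun z : EuclideanSpace ℝ (Fin n) => z (i : Fin n))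
      (EuclideanSpace.proj (𝕜 := ℝ) (i : Fin n)) xstar :=
    (EuclideanSpace.proj (𝕜 := ℝ) (i : Fin n)).hasFDerivAt
  have h5 := HasDerivAt.comp_hasFDerivAt (f := fun z : EuclideanSpace ℝ (Fin n) => z (i : Fin n))
    xstar h2 h4
  exact h1.add h5

lemma auxD_inv {n : ℕ} (S : IRL1 n) 
    (xstar : EuclideanSpace ℝ (Fin n)) (Istar : Finset (Fin n))
    (H : Matrix Istar Istar ℝ)
    (hH : ∀ i j : Istar, H i j =
      iteratedFDeriv ℝ 2 S.f xstar
        ![EuclideanSpace.single (i : Fin n) 1, EuclideanSpace.single (j : Fin n) 1] +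
      (if i = j then S.lam * (S.p * (S.p - 1) * |xstar (i : Fin n)| ^ (S.p - 2)) else 0))
    (hdet : IsUnit H.det) :
    ∃ C : ℝ, 0 < C ∧ ∀ v : EuclideanSpace ℝ (Fin n), (∀ i, i ∉ Istar → v i = 0) →
      ‖v‖ ≤ C * ‖auxD S xstar Istar v‖ := by
  classical
  let ext : (Istar → ℝ) →ₗ[ℝ] EuclideanSpace ℝ (Fin n) :=
    ∑ j : Istar, (LinearMap.proj j).smulRight (EuclideanSpace.single (j : Fin n) (1:ℝ))
  let T : (Istar → ℝ) →L[ℝ] EuclideanSpace ℝ (Fin n) :=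
    LinearMap.toContinuousLinearMap (ext ∘ₗ Matrix.mulVecLin (H.transpose)⁻¹)
  have hext : ∀ v : EuclideanSpace ℝ (Fin n), (∀ i, i ∉ Istar → v i = 0) →
      v = ∑ j : Istar, v (j : Fin n) • EuclideanSpace.single (j : Fin n) (1:ℝ) := by
    intro v hv
    ext i
    rw [Finset.sum_coe_sort Istar (fun j => v j • EuclideanSpace.single j (1:ℝ))]
    simp only [WithLp.ofLp_sum, Finset.sum_apply, PiLp.smul_apply, smul_eq_mul]
    by_cases hi : i ∈ Istar
    · rw [Finset.sum_eq_single i]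
      · simp
      · intro b _ hb
        simp [hb.symm]
      · intro h; exact absurd hi h
    · rw [hv i hi, Finset.sum_eq_zero]
      intro b hb
      have : i ≠ b := fun h => hi (h ▸ hb)
      simp [this]
  have hT : ∀ v : EuclideanSpace ℝ (Fin n), (∀ i, i ∉ Istar → v i = 0) →
      T (auxD S xstar Istar v) = v := by
    intro v hv
    have hD : auxD S xstar Istar v = H.transpose.mulVec (fun j : Istar => v (j : Fin n)) := by
      funext i
      simp only [Matrix.mulVec, dotProduct, Matrix.transpose_apply, hH, iteratedFDeriv_two_apply,
        add_mul, Finset.sum_add_distrib, Matrix.cons_val_zero, Matrix.cons_val_one, ite_mul,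
        zero_mul, Finset.sum_ite_eq', Finset.mem_univ, if_true]
      simp only [auxD, ContinuousLinearMap.pi_apply, _root_.add_apply,
        ContinuousLinearMap.comp_apply, ContinuousLinearMap.apply_apply,
        _root_.smul_apply, smul_eq_mul]
      refine congrArg₂ (· + ·) ?_ rfl
      conv_lhs => rw [hext v hv]
      simp only [map_sum, map_smul, _root_.sum_apply,
        _root_.smul_apply, smul_eq_mul]
      exact Finset.sum_congr rfl fun j _ => mul_comm _ _
    have hdet' : IsUnit (H.transpose).det := by rwa [Matrix.det_transpose]
    have : T (auxD S xstar Istar v) = ext ((H.transpose)⁻¹.mulVec (auxD S xstar Istar v)) := rfl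
    rw [this, hD, Matrix.mulVec_mulVec, Matrix.nonsing_inv_mul _ hdet', Matrix.one_mulVec]
    conv_rhs => rw [hext v hv]
    simp [ext]
  refine ⟨‖T‖ + 1, by positivity, fun v hv => ?_⟩
  calc ‖v‖ = ‖T (auxD S xstar Istar v)‖ := by rw [hT v hv]
    _ ≤ ‖T‖ * ‖auxD S xstar Istar v‖ := T.le_opNorm _
    _ ≤ _ := by nlinarith [norm_nonneg (auxD S xstar Istar v)]

/-- In the IRL1 setting with bounded level set, if `f` is twice
continuously differentiable, `x*` is a limit point of `{x^k}` whose support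
`I* = {i : x*_i ≠ 0}` is the eventual support of the iterates, and the matrix
`H = [∇²f(x*)]_{I*,I*} + λ diag(p(p-1)|x*_i|^(p-2) : i ∈ I*)` is nonsingular,
then `x^k → x*`. -/
theorem stmt14 {n : ℕ} (S : IRL1 n) (hbdd : S.LevelBounded)
    (hC2 : ContDiff ℝ 2 S.f)
    (xstar : EuclideanSpace ℝ (Fin n))
    (hcluster : ∃ φ : ℕ → ℕ, StrictMono φ ∧
      Tendsto (fun k => S.x (φ k)) atTop (nhds xstar))
    (Istar : Finset (Fin n))
    (hIstar : ∀ i : Fin n, i ∈ Istar ↔ xstar i ≠ 0)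
    (hev : ∃ K : ℕ, ∀ k > K, ∀ i : Fin n, S.x k i ≠ 0 ↔ i ∈ Istar)
    (H : Matrix Istar Istar ℝ)
    (hH : ∀ i j : Istar, H i j =
      iteratedFDeriv ℝ 2 S.f xstar
        ![EuclideanSpace.single (i : Fin n) 1, EuclideanSpace.single (j : Fin n) 1] +
      (if i = j then S.lam * (S.p * (S.p - 1) * |xstar (i : Fin n)| ^ (S.p - 2)) else 0))
    (hdet : IsUnit H.det) :
    Tendsto S.x atTop (nhds xstar) := by
  obtain ⟨K, hK⟩ := hev
  have hstep := aux_step S xstar hcluster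
  obtain ⟨C, hC, hCb⟩ := auxD_inv S xstar Istar H hH hdet
  have hder := auxPhi_hasFDerivAt S hC2 xstar Istar hIstar
  -- local lower bound on the residual
  have hlow : ∀ᶠ z in 𝓝 xstar, (∀ i, i ∉ Istar → z i = 0) →
      ‖z - xstar‖ ≤ 2 * C * ‖auxPhi S xstar Istar z - auxPhi S xstar Istar xstar‖ := by
    have ho := hder.isLittleO.bound (show (0:ℝ) < 1 / (2 * C) by positivity)
    filter_upwards [ho] with z hz hsupp
    have hv : ∀ i, i ∉ Istar → (z - xstar) i = 0 := by
      intro i hi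
      have : xstar i = 0 := by
        by_contra h
        exact hi ((hIstar i).2 h)
      simp [hsupp i hi, this]
    have h1 := hCb _ hv
    have h2 : ‖auxD S xstar Istar (z - xstar)‖ ≤
        ‖auxPhi S xstar Istar z - auxPhi S xstar Istar xstar‖ +
        1 / (2 * C) * ‖z - xstar‖ := by
      have := norm_sub_le (auxPhi S xstar Istar z - auxPhi S xstar Istar xstar)
        (auxPhi S xstar Istar z - auxPhi S xstar Istar xstar - auxD S xstar Istar (z - xstar))
      rw [sub_sub_cancel] at this
      linarith
    have h3 := mul_le_mul_of_nonneg_left h2 hC.le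
    have h4 : C * (1 / (2 * C) * ‖z - xstar‖) = ‖z - xstar‖ / 2 := by
      field_simp
    rw [mul_add, h4] at h3
    linarith
  have hsign : ∀ᶠ z in 𝓝 xstar, ∀ i ∈ Istar,
      SignType.sign (z i) = SignType.sign (xstar i) ∧ |xstar i| / 2 ≤ |z i| := by
    rw [Filter.eventually_all_finset]
    intro i hi
    have hne := (hIstar i).1 hi
    have hcont : Tendsto (fun z : EuclideanSpace ℝ (Fin n) => z i) (𝓝 xstar) (𝓝 (xstar i)) :=
      (EuclideanSpace.proj (𝕜 := ℝ) i).continuous.tendsto xstar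
    have ha : ∀ᶠ z in 𝓝 xstar, |xstar i| / 2 < |z i| :=
      hcont.abs.eventually (lt_mem_nhds (half_lt_self (abs_pos.2 hne)))
    rcases lt_or_gt_of_ne hne with h | h
    · filter_upwards [ha, hcont.eventually (gt_mem_nhds h)] with z hz1 hz2
      exact ⟨by rw [sign_neg h, sign_neg hz2], hz1.le⟩
    · filter_upwards [ha, hcont.eventually (lt_mem_nhds h)] with z hz1 hz2
      exact ⟨by rw [sign_pos h, sign_pos hz2], hz1.le⟩
  obtain ⟨r, hr, hball⟩ := Metric.eventually_nhds_iff.1 (hlow.and hsign)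
  -- residual is small along the iterates staying near xstar
  have hres : ∀ η > 0, ∀ᶠ k in atTop, dist (S.x k) xstar < r / 2 →
      ‖auxPhi S xstar Istar (S.x k)‖ < η := by
    intro η hη
    have hb : ∀ᶠ k in atTop, ∀ i : Istar, S.L * ‖S.x (k+1) - S.x k‖ +
        S.lam * (S.p * ((|xstar (i : Fin n)| / 2) ^ (S.p - 2) * S.eps k i)) < η := by
      rw [Filter.eventually_all]
      intro i
      have h1 : Tendsto (fun k => S.L * ‖S.x (k+1) - S.x k‖ +
        S.lam * (S.p * ((|xstar (i : Fin n)| / 2) ^ (S.p - 2) * S.eps k i))) atTop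
          (𝓝 (S.L * 0 + S.lam * (S.p * ((|xstar (i : Fin n)| / 2) ^ (S.p - 2) * 0)))) :=
        (hstep.const_mul _).add ((((aux_eps S i).const_mul _).const_mul _).const_mul _)
      simp only [mul_zero, add_zero] at h1
      exact h1.eventually (gt_mem_nhds hη)
    filter_upwards [hb, hstep.eventually (gt_mem_nhds (half_pos hr)), eventually_gt_atTop K]
      with k hk1 hk2 hk3 hk4
    rw [pi_norm_lt_iff hη]
    intro i
    refine lt_of_le_of_lt ?_ (hk1 i)
    have hx1 : dist (S.x (k+1)) xstar < r := by
      have := dist_triangle (S.x (k+1)) (S.x k) xstar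
      rw [dist_eq_norm (S.x (k+1)) (S.x k)] at this
      linarith
    have hs1 := ((hball hx1).2 i i.2).1
    have hs2 := ((hball (show dist (S.x k) xstar < r by linarith)).2 i i.2).2
    have hne : S.x (k+1) i ≠ 0 := (hK (k+1) (by omega) i).2 i.2
    have hR := aux_resid S k i hne
    rw [hs1] at hR
    have hpos : 0 < |xstar (i : Fin n)| / 2 := half_pos (abs_pos.2 ((hIstar i).1 i.2))
    have hd := aux_rpow_diff S.hp0 S.hp1 hpos hs2 (S.heps_pos k i)
    have hsg : |(SignType.sign (xstar (i : Fin n)) : ℝ)| ≤ 1 := by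
      rcases SignType.sign (xstar (i : Fin n)) with _ | _ | _ <;> simp
    have heq : auxPhi S xstar Istar (S.x k) i =
        (fderiv ℝ S.f (S.x k) (EuclideanSpace.single (i : Fin n) 1) +
        S.lam * (wfun S.p (S.x k i) (S.eps k i) * (SignType.sign (xstar (i : Fin n)) : ℝ))) -
        S.lam * (S.p * (((|S.x k i| + S.eps k i) ^ (S.p - 1) - |S.x k i| ^ (S.p - 1)) *
          (SignType.sign (xstar (i : Fin n)) : ℝ))) := by
      unfold auxPhi wfun; ring
    rw [heq, Real.norm_eq_abs]
    refine (abs_sub _ _).trans (add_le_add hR ?_)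
    rw [abs_mul, abs_mul, abs_mul, abs_of_pos S.hlam, abs_of_pos S.hp0]
    refine mul_le_mul_of_nonneg_left (mul_le_mul_of_nonneg_left ?_ S.hp0.le) S.hlam.le
    calc _ ≤ |(|S.x k i| + S.eps k i) ^ (S.p - 1) - |S.x k i| ^ (S.p - 1)| * 1 :=
          mul_le_mul_of_nonneg_left hsg (abs_nonneg _)
      _ ≤ _ := by rw [mul_one]; exact hd
  have hzero : auxPhi S xstar Istar xstar = 0 := by
    obtain ⟨φ, hφ, hx⟩ := hcluster
    have h1 := hder.continuousAt.tendsto.comp hx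
    refine tendsto_nhds_unique h1 ?_
    rw [Metric.tendsto_nhds]
    intro η hη
    filter_upwards [hφ.tendsto_atTop.eventually (hres η hη),
      (Metric.tendsto_nhds.1 hx) (r / 2) (half_pos hr)] with k hk1 hk2
    rw [dist_zero_right]
    exact hk1 hk2
  have hclose : ∀ η > 0, ∀ᶠ k in atTop, dist (S.x k) xstar < r / 2 →
      dist (S.x k) xstar < η := by
    intro η hη
    filter_upwards [hres (η / (2 * C)) (by positivity), eventually_gt_atTop K] with k hk1 hk2 hk3
    have hsupp : ∀ i, i ∉ Istar → S.x k i = 0 := by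
      intro i hi
      by_contra h
      exact hi ((hK k hk2 i).1 h)
    have h1 := (hball (show dist (S.x k) xstar < r by linarith)).1 hsupp
    rw [hzero, sub_zero] at h1
    have h2 := hk1 hk3
    rw [lt_div_iff₀ (by positivity)] at h2
    rw [dist_eq_norm]
    linarith
  rw [Metric.tendsto_nhds]
  intro η hη
  have hη' : 0 < min η (r / 4) := lt_min hη (by linarith)
  obtain ⟨N, hN⟩ := eventually_atTop.1 ((hclose _ hη').and
    (hstep.eventually (gt_mem_nhds (show 0 < r / 4 by linarith))))
  obtain ⟨k0, hk0, hk0x⟩ : ∃ k ≥ N, dist (S.x k) xstar < r / 2 := by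
    obtain ⟨φ, hφ, hx⟩ := hcluster
    obtain ⟨m, hm1, hm2⟩ := ((Metric.tendsto_nhds.1 hx (r / 2) (half_pos hr)).and
      (hφ.tendsto_atTop.eventually (eventually_ge_atTop N))).exists
    exact ⟨φ m, hm2, hm1⟩
  have hind : ∀ k ≥ k0, dist (S.x k) xstar < r / 2 := by
    intro k hk
    induction k, hk using Nat.le_induction with
    | base => exact hk0x
    | succ k hk ih =>
      have h1 := hN k (hk0.trans hk)
      have h2 := (h1.1 ih).trans_le (min_le_right _ _)
      have h3 := dist_triangle (S.x (k+1)) (S.x k) xstar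
      rw [dist_eq_norm (S.x (k+1)) (S.x k)] at h3
      linarith [h1.2]
  filter_upwards [eventually_ge_atTop k0] with k hk
  exact ((hN k (hk0.trans hk)).1 (hind k hk)).trans_le (min_le_left _ _)
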